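/- Let $Q \subseteq [0,1]^E$ be a $\{0,1\}$-polytope all of whose vertices have the property that no vertex is componentwise dominated by another, and suppose every edge direction of the dominant $Q^{\uparrow}$ is parallel to some $\chi_e - \chi_f$. Then all vertices of $Q$ have the same number of ones, i.e., all vertices lie on a common hyperplane $\sum_{e \in E} x_e = b$ for some integer $b$. -/

import Mathlib

open Finset

/-- `segment ℝ u v` (with `u ≠ v`) is a (bounded) edge of `Q` when it is an extreme
subset of `Q`, i.e. a one-dimensional face. -/
def IsEdgeOf {V : Type*} [AddCommGroup V] [Module ℝ V] (Q : Set V) (u v : V) : Prop :=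
  u ≠ v ∧ IsExtreme ℝ Q (segment ℝ u v)

/-- The dominant of a set `Q ⊆ ℝ^E`: `Q + ℝ₊^E`. -/
def dominant {E : Type*} (Q : Set (E → ℝ)) : Set (E → ℝ) :=
  {x | ∃ y ∈ Q, y ≤ x}

theorem cone_add {V : Type*} [AddCommGroup V] [Module ℝ V] {K : Set V} (hK : Convex ℝ K)
    {x y : V} (hx : ∃ t : ℝ, 0 ≤ t ∧ ∃ k ∈ K, x = t • k)
    (hy : ∃ t : ℝ, 0 ≤ t ∧ ∃ k ∈ K, y = t • k) :
    ∃ t : ℝ, 0 ≤ t ∧ ∃ k ∈ K, x + y = t • k := by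
  obtain ⟨t, ht, k, hk, rfl⟩ := hx
  obtain ⟨r, hr, l, hl, rfl⟩ := hy
  rcases ht.eq_or_lt with h0 | h0
  · exact ⟨r, hr, l, hl, by simp [← h0]⟩
  have hp : 0 < t + r := by linarith
  refine ⟨t + r, hp.le, (t / (t + r)) • k + (r / (t + r)) • l,
    hK hk hl (by positivity) (by positivity) (by field_simp), ?_⟩
  rw [smul_add, smul_smul, smul_smul, mul_div_cancel₀ _ hp.ne', mul_div_cancel₀ _ hp.ne']

theorem weight_pos {E : Type*} [Fintype E] (w v : E → ℝ)
    (hw : ∀ e, w e = 0 ∨ w e = 1) (hv : ∀ e, v e = 0 ∨ v e = 1) (h : ¬ v ≤ w)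
    (γ : E → ℝ) (h0 : ∀ e, w e = 0 → γ e = Fintype.card E + 1) (h1 : ∀ e, w e = 1 → γ e = 1) :
    0 < ∑ e, γ e * (v e - w e) := by
  obtain ⟨e0, he0⟩ : ∃ e, ¬ v e ≤ w e := by
    by_contra hc; push Not at hc; exact h hc
  have hn : ∀ e, 0 ≤ γ e * (v e - w e) + 1 := by
    intro e
    rcases hw e with a | a
    · rw [h0 e a, a]
      rcases hv e with b | b <;> rw [b] <;> ring_nf <;> positivity
    · rw [h1 e a, a]
      rcases hv e with b | b <;> rw [b] <;> norm_num
  have hs := Finset.single_le_sum (f := fun e => γ e * (v e - w e) + 1)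
    (fun e _ => hn e) (Finset.mem_univ e0)
  have hwe : w e0 = 0 := by
    rcases hw e0 with a | a
    · exact a
    · rcases hv e0 with b | b <;> rw [a, b] at he0 <;> norm_num at he0
  have hve : v e0 = 1 := by
    rcases hv e0 with b | b
    · rw [hwe, b] at he0; norm_num at he0
    · exact b
  simp only [Finset.sum_add_distrib, hwe, hve, h0 e0 hwe] at hs
  simp at hs
  linarith

theorem exists_neg_extreme {V : Type*} [AddCommGroup V] [Module ℝ V] [TopologicalSpace V]
    [T2Space V] [IsTopologicalAddGroup V] [ContinuousSMul ℝ V] [LocallyConvexSpace ℝ V]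
    {K : Set V} (hc : IsCompact K) (hK : Convex ℝ K) (s : V →L[ℝ] ℝ) {x : V} (hx : x ∈ K)
    (hs : s x < 0) : ∃ p ∈ K.extremePoints ℝ, s p < 0 := by
  by_contra hcon
  push Not at hcon
  have h := closure_convexHull_extremePoints hc hK
  have hcl : IsClosed {y | 0 ≤ s y} := isClosed_le continuous_const s.continuous
  have hcv : Convex ℝ {y | 0 ≤ s y} := convex_halfSpace_ge s.toLinearMap.isLinear 0
  have : K ⊆ {y | 0 ≤ s y} := by
    rw [← h]
    exact closure_minimal (convexHull_min hcon hcv) hcl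
  exact absurd (this hx) (not_le.mpr hs)

theorem key {E : Type*} [Fintype E] [DecidableEq E] (Q : Set (E → ℝ))
    (hpoly : ∃ Vs : Finset (E → ℝ), Q = convexHull ℝ (↑Vs : Set (E → ℝ)))
    (hbox : Q ⊆ {x | ∀ e, x e ∈ Set.Icc (0:ℝ) 1})
    (h01 : ∀ x ∈ Set.extremePoints ℝ Q, ∀ e, x e = 0 ∨ x e = 1)
    (hnodom : ∀ u ∈ Set.extremePoints ℝ Q, ∀ v ∈ Set.extremePoints ℝ Q,
      u ≠ v → ¬ u ≤ v)
    (hedges : ∀ u v : E → ℝ, IsEdgeOf (dominant Q) u v →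
      ∃ e f : E, e ≠ f ∧ ∃ t : ℝ, t ≠ 0 ∧
        v - u = t • (Pi.single e (1:ℝ) - Pi.single f 1))
    (w v0 : E → ℝ) (hw : w ∈ Set.extremePoints ℝ Q) (hv0 : v0 ∈ Set.extremePoints ℝ Q)
    (hlt : ∑ e, v0 e < ∑ e, w e) : False := by
  obtain ⟨Vs, hVs⟩ := hpoly
  have hconv : Convex ℝ Q := hVs ▸ convex_convexHull ℝ _
  have hcomp : IsCompact Q := hVs ▸ Vs.finite_toSet.isCompact_convexHull ℝ
  have hfin : (Set.extremePoints ℝ Q).Finite := by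
    refine Vs.finite_toSet.subset ?_
    rw [hVs]; exact extremePoints_convexHull_subset
  have hQ : convexHull ℝ (Set.extremePoints ℝ Q) = Q := by
    have h := closure_convexHull_extremePoints hcomp hconv
    rwa [(hfin.isClosed_convexHull ℝ).closure_eq] at h
  let γ : E → ℝ := fun e => if w e = 0 then Fintype.card E + 1 else 1
  have hγ : ∀ e, 0 < γ e := by
    intro e; simp only [γ]; split_ifs <;> positivity
  let s : (E → ℝ) →L[ℝ] ℝ := ∑ e, ContinuousLinearMap.proj e
  let c : (E → ℝ) →ₗ[ℝ] ℝ := ∑ e, γ e • LinearMap.proj e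
  have hs : ∀ x, s x = ∑ e, x e := by intro x; simp [s]
  have hc : ∀ x, c x = ∑ e, γ e * x e := by intro x; simp [c]
  have hcpos : ∀ v ∈ Set.extremePoints ℝ Q, v ≠ w → 0 < c (v - w) := by
    intro v hv hne
    rw [hc]
    refine weight_pos w v (h01 w hw) (h01 v hv) (hnodom v hv w hw hne) γ ?_ ?_
    · intro e he; simp [γ, he]
    · intro e he; simp [γ, he]
  have hcs : ∀ e, c (Pi.single e 1) = γ e := by
    intro e; rw [hc]; simp [Pi.single_apply]
  have hss : ∀ e, s (Pi.single e 1) = 1 := by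
    intro e; rw [hs]; simp
  let G : Set (E → ℝ) := (fun v => (c (v - w))⁻¹ • (v - w)) '' (Set.extremePoints ℝ Q \ {w})
    ∪ Set.range (fun e : E => (γ e)⁻¹ • (Pi.single e 1 : E → ℝ))
  have hGfin : G.Finite := (hfin.sdiff.image _).union (Set.finite_range _)
  let K := convexHull ℝ G
  have hKc : Convex ℝ K := convex_convexHull ℝ _
  have hK1 : ∀ k ∈ K, c k = 1 := by
    have hcv : Convex ℝ {x | c x = 1} := convex_hyperplane c.isLinear 1
    refine fun k hk => convexHull_min ?_ hcv hk
    rintro x (⟨v, ⟨hv, hne⟩, rfl⟩ | ⟨e, rfl⟩)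
    · simp only [Set.mem_ofPred_eq, map_smul, smul_eq_mul]
      exact inv_mul_cancel₀ (hcpos v hv hne).ne'
    · simp only [Set.mem_ofPred_eq, map_smul, smul_eq_mul, hcs]
      exact inv_mul_cancel₀ (hγ e).ne'
  have hGK : G ⊆ K := subset_convexHull ℝ _
  have hne0 : v0 ≠ w := by rintro rfl; exact lt_irrefl _ hlt
  have hk0 : (c (v0 - w))⁻¹ • (v0 - w) ∈ K := hGK (Or.inl ⟨v0, ⟨hv0, hne0⟩, rfl⟩)
  obtain ⟨p, hp, hsp⟩ := exists_neg_extreme (hGfin.isCompact_convexHull ℝ) hKc s hk0 (by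
    rw [map_smul, smul_eq_mul, map_sub s, hs, hs]
    exact mul_neg_of_pos_of_neg (inv_pos.mpr (hcpos v0 hv0 hne0)) (by linarith))
  -- cone description of the dominant
  have hT : ∀ x ∈ dominant Q, ∃ t : ℝ, 0 ≤ t ∧ ∃ k ∈ K, x - w = t • k := by
    rintro x ⟨y, hy, hyx⟩
    have hy' : ∃ t : ℝ, 0 ≤ t ∧ ∃ k ∈ K, y - w = t • k := by
      have hcv : Convex ℝ {y | ∃ t : ℝ, 0 ≤ t ∧ ∃ k ∈ K, y - w = t • k} := by
        rintro a ⟨t, ht, k, hk, ha⟩ b ⟨r, hr, l, hl, hb⟩ α β hα hβ hαβ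
        have := cone_add hKc (x := (α * t) • k) (y := (β * r) • l)
          ⟨_, mul_nonneg hα ht, k, hk, rfl⟩ ⟨_, mul_nonneg hβ hr, l, hl, rfl⟩
        have e : α • a + β • b - w = (α * t) • k + (β * r) • l := by
          rw [mul_smul, mul_smul, ← ha, ← hb]
          have : w = (α + β) • w := by rw [hαβ, one_smul]
          nth_rewrite 1 [this]
          module
        simpa only [Set.mem_ofPred_eq, e] using this
      rw [← hQ] at hy
      refine convexHull_min ?_ hcv hy
      intro v hv
      by_cases hvw : v = w
      · exact ⟨0, le_rfl, _, hk0, by simp [hvw]⟩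
      · refine ⟨c (v - w), (hcpos v hv hvw).le, _, hGK (Or.inl ⟨v, ⟨hv, hvw⟩, rfl⟩), ?_⟩
        simp only [smul_smul]
        rw [mul_inv_cancel₀ (hcpos v hv hvw).ne', one_smul]
    have hz : ∀ S : Finset E, ∃ t : ℝ, 0 ≤ t ∧ ∃ k ∈ K,
        ∑ e ∈ S, (x e - y e) • (Pi.single e 1 : E → ℝ) = t • k := by
      intro S
      induction S using Finset.induction_on with
      | empty => exact ⟨0, le_rfl, _, hk0, by simp⟩
      | insert a S ha ih =>
        rw [Finset.sum_insert ha]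
        refine cone_add hKc ⟨(x a - y a) * γ a, mul_nonneg (sub_nonneg.mpr (hyx a)) (hγ a).le, _,
          hGK (Or.inr ⟨a, rfl⟩), ?_⟩ ih
        simp only [smul_smul]
        rw [mul_assoc, mul_inv_cancel₀ (hγ a).ne', mul_one]
    have hxy : x - w = (y - w) + ∑ e, (x e - y e) • (Pi.single e 1 : E → ℝ) := by
      ext i
      simp [Finset.sum_apply, Pi.single_apply]
    rw [hxy]
    exact cone_add hKc hy' (hz _)
  -- identify p
  rcases extremePoints_convexHull_subset hp with ⟨v, ⟨hv, hvw⟩, rfl⟩ | ⟨e, rfl⟩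
  swap
  · simp only [map_smul, hss, smul_eq_mul, mul_one] at hsp
    exact absurd hsp (not_lt.mpr (inv_pos.mpr (hγ e)).le)
  have hvw : v ≠ w := hvw
  have hD := hcpos v hv hvw
  simp only at hp hsp
  set D := c (v - w) with hDdef
  set p : E → ℝ := D⁻¹ • (v - w) with hpdef
  have hvp : v - w = D • p := by rw [hpdef, smul_smul, mul_inv_cancel₀ hD.ne', one_smul]
  have hsubP : Q ⊆ dominant Q := fun y hy => ⟨y, hy, le_rfl⟩
  -- the coordinate bound
  obtain ⟨e0, he0⟩ : ∃ e, ¬ w e ≤ v e := by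
    by_contra hcc; push Not at hcc; exact hnodom w hw v hv hvw.symm hcc
  have hw1 : w e0 = 1 ∧ v e0 = 0 := by
    rcases h01 w hw e0 with a | a <;> rcases h01 v hv e0 with b | b <;> rw [a, b] at he0 <;>
      first | exact ⟨a, b⟩ | norm_num at he0
  have hbound : ∀ x ∈ dominant Q, ∀ t : ℝ, x - w = t • p → t ≤ D := by
    rintro x ⟨y, hy, hyx⟩ t ht
    have h1 : 0 ≤ x e0 := (hbox hy e0).1.trans (hyx e0)
    have h2 := congrFun ht e0
    simp only [hpdef, Pi.sub_apply, Pi.smul_apply, smul_eq_mul, hw1.1, hw1.2] at h2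
    have h3 : t * D⁻¹ ≤ 1 := by linarith
    rwa [← div_eq_mul_inv, div_le_one hD] at h3
  have hseg : ∀ x : E → ℝ, ∀ t : ℝ, 0 ≤ t → t ≤ D → x - w = t • p → x ∈ segment ℝ w v := by
    intro x t h0 h1 hx
    rw [segment_eq_image']
    refine ⟨t / D, ⟨by positivity, (div_le_one hD).mpr h1⟩, ?_⟩
    simp only
    rw [hvp, smul_smul, div_mul_cancel₀ _ hD.ne', ← hx]
    abel
  have hedge : IsEdgeOf (dominant Q) w v := by
    refine ⟨hvw.symm, (hconv.segment_subset hw.1 hv.1).trans hsubP, ?_⟩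
    intro x₁ hx₁ x₂ hx₂ x hx hxo
    obtain ⟨t₁, ht₁, k₁, hk₁, e₁⟩ := hT x₁ hx₁
    obtain ⟨t₂, ht₂, k₂, hk₂, e₂⟩ := hT x₂ hx₂
    obtain ⟨a, b, ha, hb, hab, rfl⟩ := hxo
    rw [segment_eq_image'] at hx
    obtain ⟨θ, ⟨hθ0, hθ1⟩, hθ⟩ := hx
    simp only at hθ
    have hmain : (a * t₁) • k₁ + (b * t₂) • k₂ = (θ * D) • p := by
      rw [mul_smul, mul_smul, mul_smul, ← e₁, ← e₂, ← hvp]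
      have h2 : θ • (v - w) = a • x₁ + b • x₂ - (a + b) • w := by
        rw [← hθ, hab, one_smul]; abel
      rw [h2]; module
    have hct : a * t₁ + b * t₂ = θ * D := by
      have := congrArg c hmain
      simpa [hK1 k₁ hk₁, hK1 k₂ hk₂, hK1 p hp.1] using this
    rcases ht₁.eq_or_lt with h1 | h1
    · exact hseg x₁ 0 le_rfl hD.le (by rw [e₁, ← h1]; simp)
    have hpos : 0 < θ * D := by
      rw [← hct]; have := mul_pos ha h1; have := mul_nonneg hb.le ht₂; linarith
    have hpe : p = (a * t₁ / (θ * D)) • k₁ + (b * t₂ / (θ * D)) • k₂ := by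
      have : p = (θ * D)⁻¹ • ((θ * D) • p) := by
        rw [smul_smul, inv_mul_cancel₀ hpos.ne', one_smul]
      rw [this, ← hmain, smul_add, smul_smul, smul_smul, div_eq_inv_mul, div_eq_inv_mul]
    have hk : k₁ = p := by
      rcases ht₂.eq_or_lt with h2 | h2
      · rw [← h2, mul_zero, add_zero] at hct
        rw [hpe, hct, ← h2, div_self hpos.ne']; simp
      · refine hp.2 hk₁ hk₂ ⟨a * t₁ / (θ * D), b * t₂ / (θ * D), by positivity, by positivity, ?_,
          hpe.symm⟩
        rw [← add_div, hct, div_self hpos.ne']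
    rw [hk] at e₁
    exact hseg x₁ t₁ ht₁ (hbound x₁ hx₁ t₁ e₁) e₁
  obtain ⟨e, f, -, t, -, hvt⟩ := hedges w v hedge
  have h1 : s (v - w) = 0 := by rw [hvt, map_smul, map_sub, hss, hss]; simp
  rw [hvp, map_smul, smul_eq_mul] at h1
  have := mul_neg_of_pos_of_neg hD hsp
  linarith

theorem stmt5 {E : Type*} [Fintype E] [DecidableEq E] (Q : Set (E → ℝ))
    (hpoly : ∃ Vs : Finset (E → ℝ), Q = convexHull ℝ (↑Vs : Set (E → ℝ)))
    (hbox : Q ⊆ {x | ∀ e, x e ∈ Set.Icc (0:ℝ) 1})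
    (h01 : ∀ x ∈ Set.extremePoints ℝ Q, ∀ e, x e = 0 ∨ x e = 1)
    (hnodom : ∀ u ∈ Set.extremePoints ℝ Q, ∀ v ∈ Set.extremePoints ℝ Q,
      u ≠ v → ¬ u ≤ v)
    (hedges : ∀ u v : E → ℝ, IsEdgeOf (dominant Q) u v →
      ∃ e f : E, e ≠ f ∧ ∃ t : ℝ, t ≠ 0 ∧
        v - u = t • (Pi.single e (1:ℝ) - Pi.single f 1)) :
    ∃ b : ℤ, ∀ x ∈ Set.extremePoints ℝ Q, ∑ e, x e = (b : ℝ) := by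
  have hK := key Q hpoly hbox h01 hnodom hedges
  rcases (Set.extremePoints ℝ Q).eq_empty_or_nonempty with h | ⟨w, hw⟩
  · exact ⟨0, by simp [h]⟩
  · refine ⟨∑ e, (if w e = 0 then 0 else 1), fun x hx => ?_⟩
    have hwe : ∑ e, w e = ((∑ e, (if w e = 0 then 0 else 1) : ℤ) : ℝ) := by
      push_cast
      refine Finset.sum_congr rfl fun e _ => ?_
      rcases h01 w hw e with a | a <;> simp [a]
    rw [← hwe]
    exact le_antisymm (not_lt.mp fun h => hK x w hx hw h) (not_lt.mp fun h => hK w x hw hx h)
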